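/- Let A be a separable unital C*-algebra and let K, L ⊆ A be two compact generating sets. Then the metrics d_K and d_L on Rep(A) are uniformly equivalent: for every ε > 0 there exists δ > 0 such that for all π, π' ∈ Rep(A), d_K(π,π') < δ implies d_L(π,π') < ε (and symmetrically with the roles of K and L exchanged). -/

import Mathlib

noncomputable section

abbrev H2 : Type := lp (fun _ : ℕ => ℂ) 2
abbrev BH : Type := H2 →L[ℂ] H2

abbrev RepSp (A : Type*) [CStarAlgebra A] := A →⋆ₐ[ℂ] BH

def Generates {A : Type*} [CStarAlgebra A] (K : Set A) : Prop :=
  (StarAlgebra.adjoin ℂ K).topologicalClosure = ⊤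

def dRep {A : Type*} [CStarAlgebra A] (K : Set A) (π₁ π₂ : RepSp A) : ℝ :=
  ⨆ a ∈ K, ‖π₁ a - π₂ a‖

open Filter Topology

theorem norm_sub_le_dRep {A : Type*} [CStarAlgebra A] {K : Set A} (hK : IsCompact K)
    (π π' : RepSp A) {a : A} (ha : a ∈ K) : ‖π a - π' a‖ ≤ dRep K π π' := by
  obtain ⟨C, hC⟩ := hK.isBounded.exists_norm_le
  have hbdd : BddAbove (Set.range fun a : A => ⨆ _ : a ∈ K, ‖π a - π' a‖) := by
    refine ⟨max (C + C) 0, ?_⟩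
    rintro _ ⟨b, rfl⟩
    refine Real.iSup_le (fun hb => le_max_of_le_left ?_) (le_max_right _ _)
    exact (norm_sub_le _ _).trans (add_le_add
      ((NonUnitalStarAlgHom.norm_apply_le π b).trans (hC b hb))
      ((NonUnitalStarAlgHom.norm_apply_le π' b).trans (hC b hb)))
  refine le_trans ?_ (le_ciSup hbdd a)
  simp [ha]

theorem dRep_nonneg {A : Type*} [CStarAlgebra A] (K : Set A) (π π' : RepSp A) :
    0 ≤ dRep K π π' :=
  Real.iSup_nonneg fun _ => Real.iSup_nonneg fun _ => norm_nonneg _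

theorem dRep_le {A : Type*} [CStarAlgebra A] {K : Set A} {π π' : RepSp A} {r : ℝ} (hr : 0 ≤ r)
    (h : ∀ a ∈ K, ‖π a - π' a‖ ≤ r) : dRep K π π' ≤ r :=
  Real.iSup_le (fun a => Real.iSup_le (h a) hr) hr

/-- If `K` generates `A`, then pairs of representations that are `dRep K`-close are close at
every element of `A`. -/
theorem tendsto_norm_sub_comap_dRep {A : Type*} [CStarAlgebra A] {K : Set A} (hK : IsCompact K)
    (hgen : Generates K) (a : A) :
    Tendsto (fun p : RepSp A × RepSp A => ‖p.1 a - p.2 a‖)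
      (comap (fun p => dRep K p.1 p.2) (𝓝 0)) (𝓝 0) := by
  have hadj : ∀ b ∈ StarAlgebra.adjoin ℂ K,
      Tendsto (fun p : RepSp A × RepSp A => ‖p.1 b - p.2 b‖)
        (comap (fun p => dRep K p.1 p.2) (𝓝 0)) (𝓝 0) := by
    intro b hb
    induction hb using StarAlgebra.adjoin_induction with
    | mem x hx =>
      exact squeeze_zero (fun _ => norm_nonneg _) (fun p => norm_sub_le_dRep hK p.1 p.2 hx)
        tendsto_comap
    | algebraMap r =>
      simpa only [AlgHomClass.commutes, sub_self, norm_zero] using tendsto_const_nhds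
    | add x y _ _ hx hy =>
      refine squeeze_zero (fun _ => norm_nonneg _) (fun p => ?_) (by simpa using hx.add hy)
      rw [map_add, map_add, add_sub_add_comm]
      exact norm_add_le _ _
    | mul x y _ _ hx hy =>
      refine squeeze_zero (fun _ => norm_nonneg _) (fun p => ?_)
        (by simpa using (hy.const_mul ‖x‖).add (hx.mul_const ‖y‖))
      have hsplit : p.1 (x * y) - p.2 (x * y)
          = p.1 x * (p.1 y - p.2 y) + (p.1 x - p.2 x) * p.2 y := by
        rw [map_mul, map_mul, mul_sub, sub_mul, sub_add_sub_cancel]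
      rw [hsplit]
      refine (norm_add_le _ _).trans (add_le_add ?_ ?_)
      · exact (norm_mul_le _ _).trans (mul_le_mul_of_nonneg_right
          (NonUnitalStarAlgHom.norm_apply_le p.1 x) (norm_nonneg _))
      · exact (norm_mul_le _ _).trans (mul_le_mul_of_nonneg_left
          (NonUnitalStarAlgHom.norm_apply_le p.2 y) (norm_nonneg _))
    | star x _ hx =>
      refine hx.congr fun p => ?_
      rw [map_star, map_star, ← star_sub, norm_star]
  have ha : a ∈ closure (StarAlgebra.adjoin ℂ K : Set A) := by
    rw [← StarSubalgebra.topologicalClosure_coe, hgen]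
    trivial
  rw [Metric.tendsto_nhds]
  intro ε hε
  obtain ⟨b, hb, hab⟩ := Metric.mem_closure_iff.1 ha (ε / 3) (by positivity)
  filter_upwards [(hadj b hb).eventually_lt_const (show 0 < ε / 3 by positivity)] with p hp
  rw [dist_eq_norm] at hab
  have h1 := (NonUnitalStarAlgHom.norm_apply_le p.1 (a - b)).trans_lt hab
  have h2 := (NonUnitalStarAlgHom.norm_apply_le p.2 (a - b)).trans_lt hab
  have hsplit : p.1 a - p.2 a = p.1 (a - b) + (p.1 b - p.2 b) - p.2 (a - b) := by
    rw [map_sub, map_sub]; abel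
  have h3 := norm_sub_le (p.1 (a - b) + (p.1 b - p.2 b)) (p.2 (a - b))
  have h4 := norm_add_le (p.1 (a - b)) (p.1 b - p.2 b)
  rw [← hsplit] at h3
  rw [Real.dist_0_eq_abs, abs_norm]
  linarith

theorem exists_dRep_lt_of_generates {A : Type*} [CStarAlgebra A] {K L : Set A}
    (hK : IsCompact K) (hgen : Generates K) (hL : IsCompact L) {ε : ℝ} (hε : 0 < ε) :
    ∃ δ > (0 : ℝ), ∀ π π' : RepSp A, dRep K π π' < δ → dRep L π π' < ε := by
  obtain ⟨t, -, ht, hcover⟩ := hL.finite_cover_balls (show 0 < ε / 4 by positivity)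
  have hev : ∀ᶠ p : RepSp A × RepSp A in comap (fun p => dRep K p.1 p.2) (𝓝 0),
      ∀ b ∈ t, ‖p.1 b - p.2 b‖ < ε / 4 :=
    (eventually_all_finite ht).2 fun b _ =>
      (tendsto_norm_sub_comap_dRep hK hgen b).eventually_lt_const (by positivity)
  obtain ⟨δ, hδ, hsub⟩ := (Metric.nhds_basis_ball.comap _).eventually_iff.1 hev
  refine ⟨δ, hδ, fun π π' h => ?_⟩
  have hp := @hsub (π, π') (by simpa [abs_of_nonneg (dRep_nonneg K π π')] using h)
  suffices dRep L π π' ≤ 3 * (ε / 4) by linarith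
  refine dRep_le (by positivity) fun a ha => ?_
  obtain ⟨b, hb, hab⟩ := Set.mem_iUnion₂.1 (hcover ha)
  rw [Metric.mem_ball, dist_eq_norm] at hab
  have h1 := (NonUnitalStarAlgHom.norm_apply_le π (a - b)).trans_lt hab
  have h2 := (NonUnitalStarAlgHom.norm_apply_le π' (a - b)).trans_lt hab
  have hsplit : π a - π' a = π (a - b) + (π b - π' b) - π' (a - b) := by
    rw [map_sub, map_sub]; abel
  have h3 := norm_sub_le (π (a - b) + (π b - π' b)) (π' (a - b))
  have h4 := norm_add_le (π (a - b)) (π b - π' b)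
  rw [← hsplit] at h3
  have h5 : ‖π b - π' b‖ < ε / 4 := hp b hb
  linarith

theorem stmt5 (A : Type*) [CStarAlgebra A] [TopologicalSpace.SeparableSpace A]
    (K L : Set A) (hK : IsCompact K) (hgenK : Generates K)
    (hL : IsCompact L) (hgenL : Generates L) :
    (∀ ε > (0 : ℝ), ∃ δ > (0 : ℝ), ∀ π π' : RepSp A,
      dRep K π π' < δ → dRep L π π' < ε) ∧
    (∀ ε > (0 : ℝ), ∃ δ > (0 : ℝ), ∀ π π' : RepSp A,
      dRep L π π' < δ → dRep K π π' < ε) :=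
  ⟨fun _ hε => exists_dRep_lt_of_generates hK hgenK hL hε,
    fun _ hε => exists_dRep_lt_of_generates hL hgenL hK hε⟩
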